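/- If G is a finite nonempty P₄-free simple graph (a cograph) without isolated vertices (i.e., G contains no induced subgraph isomorphic to the path on 4 vertices) and H is any finite nonempty simple graph without isolated vertices, then γ(G □ H) ≥ (2/3) · γ(G) · γ(H). -/

import Mathlib

open Finset

/-- `s` is a dominating set of `G`: every vertex is in `s` or adjacent to a vertex of `s`. -/
def IsDominatingSet {V : Type*} (G : SimpleGraph V) (s : Set V) : Prop :=
  ∀ v : V, v ∈ s ∨ ∃ u ∈ s, G.Adj u v

/-- The domination number `γ(G)`: minimum cardinality of a dominating set. -/
noncomputable def domNum {V : Type*} [Fintype V] (G : SimpleGraph V) : ℕ :=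
  sInf {n : ℕ | ∃ s : Set V, IsDominatingSet G s ∧ s.ncard = n}

/-- The allegiance `a_G(D) = max_{v ∈ V} |D ∩ N[v]|` (closed neighborhoods). -/
noncomputable def allegiance {V : Type*} [Fintype V] (G : SimpleGraph V) (D : Set V) : ℕ :=
  Finset.univ.sup fun v : V => (D ∩ (insert v (G.neighborSet v))).ncard

/-- The power `π(G)`: minimum allegiance over all minimum dominating sets (γ-sets) of `G`. -/
noncomputable def graphPower {V : Type*} [Fintype V] (G : SimpleGraph V) : ℕ :=
  sInf {a : ℕ | ∃ D : Set V, IsDominatingSet G D ∧ D.ncard = domNum G ∧ allegiance G D = a}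
/-- `G` is `P₄`-free (a cograph): no four distinct vertices induce a path `a-b-c-d`. -/
def P4Free {V : Type*} (G : SimpleGraph V) : Prop :=
  ¬ ∃ a b c d : V, a ≠ c ∧ a ≠ d ∧ b ≠ d ∧
    G.Adj a b ∧ G.Adj b c ∧ G.Adj c d ∧ ¬ G.Adj a c ∧ ¬ G.Adj a d ∧ ¬ G.Adj b d

section Auxiliary

open scoped Classical

theorem domNum_le_card {V : Type*} [Fintype V] {G : SimpleGraph V} {s : Finset V}
    (hs : IsDominatingSet G (s : Set V)) : domNum G ≤ #s :=
  Nat.sInf_le ⟨s, hs, Set.ncard_coe_finset s⟩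

theorem exists_isDominatingSet_card_eq_domNum {V : Type*} [Fintype V] (G : SimpleGraph V) :
    ∃ s : Finset V, IsDominatingSet G (s : Set V) ∧ #s = domNum G := by
  obtain ⟨s, hs, hc⟩ := Nat.sInf_mem (s := {n : ℕ | ∃ s : Set V, IsDominatingSet G s ∧ s.ncard = n})
    ⟨_, Set.univ, fun v => Or.inl (Set.mem_univ v), rfl⟩
  refine ⟨s.toFinset, by simpa using hs, ?_⟩
  rw [← Set.ncard_eq_toFinset_card']
  exact hc

/-- In a `P₄`-free graph, reachable vertices are at distance at most two. -/
theorem P4Free.eq_or_adj_or_exists_adj_adj {V : Type*} {G : SimpleGraph V} (hG : P4Free G)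
    {v w : V} (h : G.Reachable v w) : w = v ∨ G.Adj v w ∨ ∃ u, G.Adj v u ∧ G.Adj u w := by
  rw [SimpleGraph.reachable_iff_reflTransGen] at h
  induction h with
  | refl => exact Or.inl rfl
  | @tail r s _ hrs ih =>
    by_contra! hcon
    obtain ⟨h1, h2, h3⟩ := hcon
    rcases ih with rfl | h | ⟨u, hvu, hur⟩
    · exact h2 hrs
    · exact h3 r h hrs
    · have hvr : ¬ G.Adj v r := fun h => h3 r h hrs
      have hus : ¬ G.Adj u s := h3 u hvu
      refine hG ⟨v, u, r, s, ?_, Ne.symm h1, ?_, hvu, hur, hrs, hvr, h2, hus⟩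
      · rintro rfl
        exact h2 hrs
      · rintro rfl
        exact h2 hvu

/-- Any vertex of a `P₄`-free graph has a partner with which it dominates its component. -/
theorem P4Free.exists_dominating_pair {V : Type*} [Fintype V] {G : SimpleGraph V} (hG : P4Free G)
    (v : V) : ∃ u, G.Reachable v u ∧
      ∀ w, G.Reachable v w → w = v ∨ G.Adj v w ∨ w = u ∨ G.Adj u w := by
  by_cases hv : ∃ u, G.Adj v u
  swap
  · refine ⟨v, SimpleGraph.Reachable.refl v, fun w hw => ?_⟩
    rcases hG.eq_or_adj_or_exists_adj_adj hw with h | h | ⟨u, h, _⟩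
    · exact Or.inl h
    · exact Or.inr (Or.inl h)
    · exact absurd ⟨u, h⟩ hv
  let R (u : V) : Finset V := univ.filter fun r => r ≠ v ∧ ¬ G.Adj v r ∧ G.Adj u r
  have hR (u r : V) : r ∈ R u ↔ r ≠ v ∧ ¬ G.Adj v r ∧ G.Adj u r := by simp [R]
  obtain ⟨u, hu, hmax⟩ := exists_max_image (univ.filter fun u => G.Adj v u) (fun u => #(R u))
    (by obtain ⟨u, hu⟩ := hv; exact ⟨u, by simpa using hu⟩)
  have hvu : G.Adj v u := by simpa using hu
  refine ⟨u, hvu.reachable, fun r hr => ?_⟩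
  by_contra! hcon
  obtain ⟨hrv, hvr, hru, hur⟩ := hcon
  obtain ⟨u', hvu', hu'r⟩ : ∃ u', G.Adj v u' ∧ G.Adj u' r := by
    rcases hG.eq_or_adj_or_exists_adj_adj hr with h | h | h
    · exact absurd h hrv
    · exact absurd h hvr
    · exact h
  obtain ⟨r', hr', hr'u'⟩ : ∃ r' ∈ R u, r' ∉ R u' := by
    by_contra! hsub
    have hlt : #(R u) < #(R u') := card_lt_card <| by
      refine ⟨hsub, fun h => hur ((hR _ _).1 (h ((hR _ _).2 ⟨hrv, hvr, hu'r⟩))).2.2⟩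
    exact absurd (hmax u' (by simpa using hvu')) (not_le.2 hlt)
  obtain ⟨hr'v, hvr', hur'⟩ := (hR _ _).1 hr'
  have hu'r' : ¬ G.Adj u' r' := fun h => hr'u' ((hR _ _).2 ⟨hr'v, hvr', h⟩)
  have hne : r' ≠ r := by rintro rfl; exact hur hur'
  by_cases huu' : G.Adj u u'
  · by_cases hrr' : G.Adj r' r
    · exact hG ⟨v, u, r', r, hr'v.symm, hrv.symm, hru.symm, hvu, hur', hrr', hvr', hvr, hur⟩
    · refine hG ⟨r', u, u', r, ?_, hne, hru.symm, hur'.symm, huu', hu'r,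
        fun h => hu'r' h.symm, hrr', hur⟩
      rintro rfl
      exact hvr' hvu'
  · refine hG ⟨r', u, v, u', hr'v, ?_, ?_, hur'.symm, hvu.symm, hvu',
      fun h => hvr' h.symm, fun h => hu'r' h.symm, huu'⟩
    · rintro rfl
      exact hvr' hvu'
    · rintro rfl
      exact hu'r' hur'

section BoxProd

variable {V W : Type*} {G : SimpleGraph V} {H : SimpleGraph W}
  {D : Finset (V × W)}

/-- The part of `D` lying over `A`. -/
noncomputable def restrictFst (D : Finset (V × W)) (A : Set V) : Finset (V × W) :=
  D.filter fun p => p.1 ∈ A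

theorem mem_restrictFst {A : Set V} {p : V × W} : p ∈ restrictFst D A ↔ p ∈ D ∧ p.1 ∈ A :=
  mem_filter

/-- The projection to `W` of the part of `D` lying over `A`. -/
noncomputable def fiberProj (D : Finset (V × W)) (A : Set V) : Finset W :=
  (restrictFst D A).image Prod.snd

theorem mem_fiberProj {A : Set V} {w : W} : w ∈ fiberProj D A ↔ ∃ v ∈ A, (v, w) ∈ D := by
  simp only [fiberProj, mem_image, mem_restrictFst, Prod.exists, exists_eq_right]
  exact exists_congr fun _ => and_comm

/-- If `w` is not dominated by the projection of `D` over `A`, then `(a, w)` is dominated by an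
element of `D` in the same `G`-layer lying outside `A`. -/
theorem exists_adj_of_not_dominated (hD : IsDominatingSet (G □ H) (D : Set (V × W)))
    {A : Set V} {w : W} (hw : w ∉ fiberProj D A) (hw' : ∀ x ∈ fiberProj D A, ¬ H.Adj x w)
    {a : V} (ha : a ∈ A) : ∃ b, b ∉ A ∧ G.Adj b a ∧ (b, w) ∈ D := by
  rcases hD (a, w) with h | ⟨⟨b, x⟩, hbx, hadj⟩
  · exact absurd (mem_fiberProj.2 ⟨a, ha, h⟩) hw
  · rw [SimpleGraph.boxProd_adj] at hadj
    rcases hadj with ⟨hba, hx⟩ | ⟨hxw, hb⟩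
    · obtain rfl : x = w := hx
      exact ⟨b, fun hb => hw (mem_fiberProj.2 ⟨b, hb, hbx⟩), hba, hbx⟩
    · obtain rfl : b = a := hb
      exact absurd hxw (hw' x (mem_fiberProj.2 ⟨b, ha, hbx⟩))

variable [Fintype W]

theorem domNum_add_card_fiberProj_le (hD : IsDominatingSet (G □ H) (D : Set (V × W)))
    {A B : Set V} (hA : A.Nonempty) (hAB : ∀ a ∈ A, ∀ b, G.Adj b a → b ∈ A ∨ b ∈ B)
    (hB : ∀ b ∈ B, ∃ a ∈ A, ¬ G.Adj b a) :
    domNum H + #(fiberProj D B) ≤ #(restrictFst D B) + #(fiberProj D A) := by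
  let M : Finset W := univ.filter fun w => w ∉ fiberProj D A ∧ ∀ x ∈ fiberProj D A, ¬ H.Adj x w
  have hM (w : W) : w ∈ M ↔ w ∉ fiberProj D A ∧ ∀ x ∈ fiberProj D A, ¬ H.Adj x w := by simp [M]
  have hdom : domNum H ≤ #(fiberProj D A) + #M := by
    refine (domNum_le_card (s := fiberProj D A ∪ M) fun w => ?_).trans (card_union_le _ _)
    by_cases hw : w ∈ M
    · exact Or.inl (by simp [hw])
    · rw [hM] at hw
      push Not at hw
      by_cases hwA : w ∈ fiberProj D A
      · exact Or.inl (by simp [hwA])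
      · obtain ⟨x, hx, hxw⟩ := hw hwA
        exact Or.inr ⟨x, by simp [hx], hxw⟩
  have hcount : #(fiberProj D B) + #M ≤ #(restrictFst D B) := by
    rw [card_eq_sum_card_fiberwise (f := Prod.snd) (t := (univ : Finset W)) (by simp),
      ← filter_univ_mem (fiberProj D B), ← filter_univ_mem M, card_filter, card_filter,
      ← sum_add_distrib]
    refine sum_le_sum fun w _ => ?_
    by_cases hw : w ∈ M
    · have hw' := (hM w).1 hw
      have hout : ∀ a ∈ A, ∃ b ∈ B, G.Adj b a ∧ (b, w) ∈ D := fun a ha => by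
        obtain ⟨b, hbA, hba, hb⟩ := exists_adj_of_not_dominated hD hw'.1 hw'.2 ha
        exact ⟨b, (hAB a ha b hba).resolve_left hbA, hba, hb⟩
      obtain ⟨a, ha⟩ := hA
      obtain ⟨b, hb, -, hbD⟩ := hout a ha
      obtain ⟨a', ha', hba'⟩ := hB b hb
      obtain ⟨b', hb', hb'a', hb'D⟩ := hout a' ha'
      have htwo : 1 < #((restrictFst D B).filter fun p => p.2 = w) :=
        one_lt_card.2 ⟨(b, w), by simp [mem_restrictFst, hb, hbD],
          (b', w), by simp [mem_restrictFst, hb', hb'D], by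
          rintro h
          obtain rfl : b = b' := congrArg Prod.fst h
          exact hba' hb'a'⟩
      split_ifs <;> omega
    · by_cases hwB : w ∈ fiberProj D B
      · obtain ⟨b, hb, hbD⟩ := mem_fiberProj.1 hwB
        have hone : 0 < #((restrictFst D B).filter fun p => p.2 = w) :=
          card_pos.2 ⟨(b, w), by simp [mem_restrictFst, hb, hbD]⟩
        simpa [hw, hwB] using hone
      · simp [hw, hwB]
  omega

theorem domNum_le_card_restrictFst (hD : IsDominatingSet (G □ H) (D : Set (V × W)))
    {C : Set V} (hC : C.Nonempty) (hclosed : ∀ a ∈ C, ∀ b, G.Adj b a → b ∈ C) :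
    domNum H ≤ #(restrictFst D C) := by
  refine (domNum_le_card (s := fiberProj D C) fun w => ?_).trans card_image_le
  by_contra! hcon
  obtain ⟨a, ha⟩ := hC
  obtain ⟨b, hb, hba, -⟩ := exists_adj_of_not_dominated hD hcon.1 hcon.2 ha
  exact hb (hclosed a ha b hba)

variable [Fintype V]

/-- If no vertex dominates the union of components `C`, then `D` has at least `2 * γ(H)` elements
over `C`. The set `C` is split into a maximal clique and its complement. -/
theorem two_mul_domNum_le_card_restrictFst (hD : IsDominatingSet (G □ H) (D : Set (V × W)))
    {C : Set V} (hC : C.Nonempty) (hclosed : ∀ a ∈ C, ∀ b, G.Adj b a → b ∈ C)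
    (hdom : ∀ v ∈ C, ∃ u ∈ C, u ≠ v ∧ ¬ G.Adj v u) :
    2 * domNum H ≤ #(restrictFst D C) := by
  obtain ⟨A, hA⟩ := Set.Finite.exists_maximal
    (Set.toFinite {A : Set V | A ⊆ C ∧ G.IsClique A}) ⟨∅, Set.empty_subset C, by simp⟩
  obtain ⟨hAC, hclique⟩ := hA.prop
  have hAB : ∀ a ∈ A, ∃ b ∈ C \ A, ¬ G.Adj a b := fun a ha => by
    obtain ⟨b, hb, hne, hnadj⟩ := hdom a (hAC ha)
    exact ⟨b, ⟨hb, fun hbA => hnadj (hclique ha hbA hne.symm)⟩, hnadj⟩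
  have hBA : ∀ b ∈ C \ A, ∃ a ∈ A, ¬ G.Adj b a := fun b hb => by
    by_contra! hcon
    have hins : insert b A ⊆ A := hA.le_of_ge
      (show insert b A ∈ {A : Set V | A ⊆ C ∧ G.IsClique A} from
        ⟨Set.insert_subset hb.1 hAC, hclique.insert fun a ha _ => hcon a ha⟩)
      (Set.subset_insert b A)
    exact hb.2 (hins (Set.mem_insert b A))
  obtain ⟨hAne, hBne⟩ : A.Nonempty ∧ (C \ A).Nonempty := by
    obtain ⟨c, hc⟩ := hC
    by_cases hcA : c ∈ A
    · obtain ⟨b, hb, -⟩ := hAB c hcA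
      exact ⟨⟨c, hcA⟩, ⟨b, hb⟩⟩
    · obtain ⟨a, ha, -⟩ := hBA c ⟨hc, hcA⟩
      exact ⟨⟨a, ha⟩, ⟨c, hc, hcA⟩⟩
  have h₁ := domNum_add_card_fiberProj_le (H := H) (B := C \ A) hD hAne
    (fun a ha b hba => (em (b ∈ A)).imp_right fun h => ⟨hclosed a (hAC ha) b hba, h⟩) hBA
  have h₂ := domNum_add_card_fiberProj_le (H := H) (B := A) hD hBne
    (fun a ha b hba => (em (b ∈ A)).symm.imp_left fun h => ⟨hclosed a ha.1 b hba, h⟩) hAB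
  have hsplit : #(restrictFst D A) + #(restrictFst D (C \ A)) ≤
      #(restrictFst D C) := by
    rw [← card_union_of_disjoint]
    · refine card_le_card fun p hp => ?_
      simp only [mem_union, mem_restrictFst] at hp ⊢
      rcases hp with h | h
      · exact ⟨h.1, hAC h.2⟩
      · exact ⟨h.1, h.2.1⟩
    · exact disjoint_left.2 fun p hp hp' => (mem_restrictFst.1 hp').2.2 (mem_restrictFst.1 hp).2
  omega

/-- Vizing's inequality for `P₄`-free graphs. -/
theorem P4Free.domNum_mul_domNum_le (hG : P4Free G) (H : SimpleGraph W) :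
    domNum G * domNum H ≤ domNum (G □ H) := by
  obtain ⟨D, hD, hcard⟩ := exists_isDominatingSet_card_eq_domNum (G □ H)
  have hcomp (c : G.ConnectedComponent) : ∃ s : Finset V,
      (∀ w ∈ c.supp, w ∈ s ∨ ∃ u ∈ s, G.Adj u w) ∧
        #s * domNum H ≤ #(restrictFst D c.supp) := by
    have hclosed : ∀ a ∈ c.supp, ∀ b, G.Adj b a → b ∈ c.supp := fun a ha b hba => by
      rw [SimpleGraph.ConnectedComponent.mem_supp_iff] at ha ⊢
      rw [← ha]
      exact SimpleGraph.ConnectedComponent.sound hba.reachable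
    by_cases hdom : ∀ v ∈ c.supp, ∃ u ∈ c.supp, u ≠ v ∧ ¬ G.Adj v u
    · obtain ⟨v, rfl⟩ := c.exists_rep
      obtain ⟨u, -, hu⟩ := hG.exists_dominating_pair v
      refine ⟨{v, u}, fun w hw => ?_, (Nat.mul_le_mul_right _ card_le_two).trans
        (two_mul_domNum_le_card_restrictFst hD (C := (G.connectedComponentMk v).supp) ⟨v, rfl⟩
          hclosed hdom)⟩
      have hvw : G.Reachable v w := (SimpleGraph.ConnectedComponent.exact hw).symm
      rcases hu w hvw with h | h | h | h
      · exact Or.inl (by simp [h])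
      · exact Or.inr ⟨v, by simp, h⟩
      · exact Or.inl (by simp [h])
      · exact Or.inr ⟨u, by simp, h⟩
    · push Not at hdom
      obtain ⟨v, hv, hdom⟩ := hdom
      refine ⟨{v}, fun w hw => ?_, ?_⟩
      · by_cases h : w = v
        · exact Or.inl (by simp [h])
        · exact Or.inr ⟨v, by simp, hdom w hw h⟩
      · rw [card_singleton, one_mul]
        exact domNum_le_card_restrictFst hD ⟨v, hv⟩ hclosed
  choose s hs hcount using hcomp
  have hunion : domNum G ≤ #(univ.biUnion s) := domNum_le_card fun w => by
    rcases hs (G.connectedComponentMk w) w rfl with h | ⟨u, hu, huw⟩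
    · exact Or.inl (by simpa using ⟨_, h⟩)
    · exact Or.inr ⟨u, by simpa using ⟨_, hu⟩, huw⟩
  calc domNum G * domNum H ≤ (∑ c, #(s c)) * domNum H :=
        Nat.mul_le_mul_right _ (hunion.trans card_biUnion_le)
    _ = ∑ c, #(s c) * domNum H := sum_mul ..
    _ ≤ ∑ c : G.ConnectedComponent, #(restrictFst D c.supp) :=
        sum_le_sum fun c _ => hcount c
    _ = #D := by
        rw [card_eq_sum_card_fiberwise (f := fun p : V × W => G.connectedComponentMk p.1)
          (t := univ) (by simp)]
        exact sum_congr rfl fun c _ => by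
          simp [restrictFst, SimpleGraph.ConnectedComponent.mem_supp_iff]
    _ = domNum (G □ H) := hcard

end BoxProd

end Auxiliary

/-- If `G` is a finite nonempty `P₄`-free graph without isolated vertices and
`H` is any finite nonempty graph without isolated vertices, then
`γ(G □ H) ≥ (2/3)·γ(G)·γ(H)`. -/
theorem domNum_boxProd_ge_of_P4Free {V W : Type*} [Fintype V] [Fintype W]
    [Nonempty V] [Nonempty W] (G : SimpleGraph V) (H : SimpleGraph W)
    (hP4 : P4Free G)
    (hG : ∀ v : V, ∃ u : V, G.Adj u v) (hH : ∀ w : W, ∃ u : W, H.Adj u w) :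
    (domNum (G □ H) : ℝ) ≥ 2 / 3 * (domNum G : ℝ) * (domNum H : ℝ) := by
  have h : (domNum G : ℝ) * domNum H ≤ domNum (G □ H) := by
    exact_mod_cast hP4.domNum_mul_domNum_le H
  have h₀ : (0 : ℝ) ≤ (domNum G : ℝ) * domNum H := by positivity
  linarith
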